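/- For each integer k with 1 ≤ k ≤ r−1, the set J_k = {x ∈ J : rank(x) = r−k} is a smooth submanifold of J of codimension k + k(k−1)d/2. In particular J₁ has codimension 1, and for k ≥ 2 the codimension of J_k is at least 3. -/

import Mathlib

open scoped BigOperators Classical

/-- Bare data of a (real) Jordan algebra: a bilinear product and a unit element. -/
structure JordanData (J : Type) [AddCommGroup J] [Module ℝ J] where
  mul : J →ₗ[ℝ] J →ₗ[ℝ] J
  e : J

namespace JordanData

variable {J : Type} [AddCommGroup J] [Module ℝ J] (A : JordanData J)

/-- `c` is an idempotent. -/
def IsIdem (c : J) : Prop := A.mul c c = c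

/-- `c` is a primitive idempotent: a nonzero idempotent which dominates only `0` and itself. -/
def IsPrimitive (c : J) : Prop :=
  A.IsIdem c ∧ c ≠ 0 ∧ ∀ d : J, A.IsIdem d → A.mul c d = d → d = 0 ∨ d = c

/-- A Jordan frame: a complete system of pairwise orthogonal primitive idempotents. -/
def IsFrame {m : ℕ} (c : Fin m → J) : Prop :=
  (∀ j, A.IsPrimitive (c j)) ∧ (∀ i j, i ≠ j → A.mul (c i) (c j) = 0) ∧ ∑ j, c j = A.e

end JordanData

/-- A simple Euclidean Jordan algebra of rank `rank`, together with its trace `tr`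
and determinant `jdet` (characterized by their values on spectral decompositions). -/
structure EJA (J : Type) [NormedAddCommGroup J] [NormedSpace ℝ J] [FiniteDimensional ℝ J]
    extends JordanData J where
  comm : ∀ x y : J, mul x y = mul y x
  unit_mul : ∀ x : J, mul e x = x
  jordan : ∀ x y : J, mul (mul x x) (mul x y) = mul x (mul (mul x x) y)
  tr : J →ₗ[ℝ] ℝ
  tr_posdef : ∀ x : J, x ≠ 0 → 0 < tr (mul x x)
  simple : ∀ I : Submodule ℝ J, (∀ x ∈ I, ∀ y : J, mul y x ∈ I) → I = ⊥ ∨ I = ⊤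
  rank : ℕ
  spectral : ∀ x : J, ∃ (c : Fin rank → J) (lam : Fin rank → ℝ),
    toJordanData.IsFrame c ∧ x = ∑ j, lam j • c j
  tr_prim : ∀ c : J, toJordanData.IsPrimitive c → tr c = 1
  jdet : J → ℝ
  jdet_frame : ∀ (c : Fin rank → J) (lam : Fin rank → ℝ),
    toJordanData.IsFrame c → jdet (∑ j, lam j • c j) = ∏ j, lam j

namespace EJA

variable {J : Type} [NormedAddCommGroup J] [NormedSpace ℝ J] [FiniteDimensional ℝ J]

def IsIdem (A : EJA J) (c : J) : Prop := A.toJordanData.IsIdem c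

def IsPrimitive (A : EJA J) (c : J) : Prop := A.toJordanData.IsPrimitive c

def IsFrame (A : EJA J) {m : ℕ} (c : Fin m → J) : Prop := A.toJordanData.IsFrame c

/-- `x` has rank `k`: in a spectral decomposition of `x`, exactly `k` eigenvalues are nonzero. -/
def HasRank (A : EJA J) (x : J) (k : ℕ) : Prop :=
  ∃ (c : Fin A.rank → J) (lam : Fin A.rank → ℝ), A.IsFrame c ∧
    x = ∑ j, lam j • c j ∧ (Finset.univ.filter fun j => lam j ≠ 0).card = k

/-- The symmetric cone `Ω`: the interior of the set of squares. -/
def cone (A : EJA J) : Set J := interior {x : J | ∃ y : J, x = A.mul y y}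

/-- The Peirce space `J(c,t)`, i.e. the `t`-eigenspace of the multiplication operator `L(c)`. -/
def peirce (A : EJA J) (c : J) (t : ℝ) : Submodule ℝ J :=
  LinearMap.ker (A.mul c - t • (LinearMap.id : J →ₗ[ℝ] J))

/-- The symmetric cone of the Jordan subalgebra `J(c,t)` (`t = 1` or `t = 0`):
the relative interior, within `J(c,t)`, of the set of squares of elements of `J(c,t)`. -/
def subCone (A : EJA J) (c : J) (t : ℝ) : Set J :=
  {x : J | x ∈ A.peirce c t ∧ ∃ U : Set J, IsOpen U ∧ x ∈ U ∧
    ∀ y ∈ U, y ∈ A.peirce c t → ∃ w ∈ A.peirce c t, y = A.mul w w}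

/-- Powers in the Jordan algebra, with `x ^ 0 = e`. -/
def pow (A : EJA J) (x : J) : ℕ → J
  | 0 => A.e
  | n + 1 => A.mul x (A.pow x n)

/-- `y` is the Jordan inverse of `x`: `y` lies in the subalgebra `ℝ[x]` and `x·y = e`. -/
def IsInverse (A : EJA J) (x y : J) : Prop :=
  y ∈ Submodule.span ℝ (Set.range (A.pow x)) ∧ A.mul x y = A.e

/-- The set of invertible linear maps preserving the symmetric cone. -/
def conePreserving (A : EJA J) : Set (J →L[ℝ] J)ˣ :=
  {g | (g : J →L[ℝ] J) '' A.cone = A.cone}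

theorem one_mem_conePreserving (A : EJA J) : 1 ∈ A.conePreserving := by
  show (↑(1 : (J →L[ℝ] J)ˣ) : J →L[ℝ] J) '' A.cone = A.cone
  simp

/-- The group `L`: the identity component of the group of linear transformations of `J`
preserving the symmetric cone `Ω`. -/
def Lgroup (A : EJA J) : Set (J →L[ℝ] J)ˣ :=
  {g | ∃ h : g ∈ A.conePreserving,
    (⟨g, h⟩ : A.conePreserving) ∈ connectedComponent ⟨1, A.one_mem_conePreserving⟩}

end EJA

namespace EJA

section Identities

variable {J : Type} [NormedAddCommGroup J] [NormedSpace ℝ J] [FiniteDimensional ℝ J]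

/-- Full linearization of the Jordan identity. -/
lemma lin (A : EJA J) (x y z w : J) :
    A.mul (A.mul x y) (A.mul z w) + A.mul (A.mul y z) (A.mul x w)
      + A.mul (A.mul x z) (A.mul y w)
    = A.mul z (A.mul (A.mul x y) w) + A.mul x (A.mul (A.mul y z) w)
      + A.mul y (A.mul (A.mul x z) w) := by
  have h1 := A.jordan (x + y + z) w
  have h2 := A.jordan (x + y) w
  have h3 := A.jordan (y + z) w
  have h4 := A.jordan (x + z) w
  have h5 := A.jordan x w
  have h6 := A.jordan y w
  have h7 := A.jordan z w
  simp only [map_add, LinearMap.add_apply] at h1 h2 h3 h4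
  rw [A.comm y x] at h1 h2
  rw [A.comm z y] at h1 h3
  rw [A.comm z x] at h1 h4
  linear_combination (norm := module) (1/2 : ℝ) • (h1 - h2 - h3 - h4 + h5 + h6 + h7)

/-- Linearized identity with the distinguished variable exchanged. -/
lemma lin2 (A : EJA J) (x z w : J) :
    (2 : ℝ) • A.mul x (A.mul z (A.mul x w)) + A.mul (A.mul (A.mul x x) z) w
    = (2 : ℝ) • A.mul (A.mul x z) (A.mul x w) + A.mul (A.mul x x) (A.mul z w) := by
  have h := A.lin x x w z
  rw [A.comm (A.mul x w) z, A.comm w z, A.comm (A.mul x w) (A.mul x z), A.comm w] at h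
  linear_combination (norm := module) -h

lemma lin' (A : EJA J) (x y z w : J) :
    A.mul (A.mul x y) (A.mul z w) + A.mul (A.mul x w) (A.mul y z)
      + A.mul (A.mul x z) (A.mul y w)
    = A.mul z (A.mul w (A.mul x y)) + A.mul x (A.mul w (A.mul z y))
      + A.mul y (A.mul w (A.mul z x)) := by
  have h := A.lin x y z w
  rw [A.comm (A.mul y z) (A.mul x w), A.comm (A.mul x y) w, A.comm (A.mul y z) w, A.comm y z,
    A.comm (A.mul x z) w, A.comm x z] at h
  rw [A.comm y z, A.comm x z]
  exact h

/-- `[L_z, L_w]` is a derivation. -/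
lemma deriv_comm (A : EJA J) (z w x y : J) :
    A.mul z (A.mul w (A.mul x y)) - A.mul w (A.mul z (A.mul x y))
    = A.mul (A.mul z (A.mul w x) - A.mul w (A.mul z x)) y
      + A.mul x (A.mul z (A.mul w y) - A.mul w (A.mul z y)) := by
  have h1 := A.lin' x y z w
  have h2 := A.lin' x y w z
  rw [A.comm w z] at h2
  rw [A.comm (A.mul z (A.mul w x) - _) y]
  simp only [map_sub]
  linear_combination (norm := module) h2 - h1

/-- Cubic relation for an idempotent. -/
lemma cubic (A : EJA J) {c : J} (hc : A.mul c c = c) (w : J) :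
    (2 : ℝ) • A.mul c (A.mul c (A.mul c w)) = (3 : ℝ) • A.mul c (A.mul c w) - A.mul c w := by
  have h := A.lin2 c c w
  rw [hc, hc] at h
  linear_combination (norm := module) h

lemma comm_orth (A : EJA J) {c a : J} (hc : A.mul c c = c) (ha : A.mul c a = 0) (w : J) :
    A.mul a (A.mul c w) = A.mul c (A.mul a w) := by
  have h := A.lin c c a w
  rw [hc, ha] at h
  simp only [map_zero, LinearMap.zero_apply, add_zero] at h
  linear_combination (norm := module) -h

lemma comm_one (A : EJA J) {c a : J} (hc : A.mul c c = c) (ha : A.mul c a = a) (w : J) :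
    A.mul a (A.mul c w) = A.mul c (A.mul a w) := by
  have h := A.lin c c a w
  rw [hc, ha] at h
  linear_combination (norm := module) h

lemma one_zero (A : EJA J) {c a b : J} (hc : A.mul c c = c) (ha : A.mul c a = a)
    (hb : A.mul c b = 0) : A.mul a b = 0 := by
  have h1 := A.comm_one hc ha b
  have h2 := A.comm_orth hc hb a
  rw [hb, map_zero] at h1
  rw [ha, A.comm b a, ← h1] at h2
  exact h2

lemma half_half (A : EJA J) {c u v : J} (hc : A.mul c c = c) (hu : A.mul c u = (1/2 : ℝ) • u)
    (hv : A.mul c v = (1/2 : ℝ) • v) : A.mul c (A.mul c (A.mul u v)) = A.mul c (A.mul u v) := by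
  have h := A.lin u v c c
  rw [hc, A.comm v c, A.comm u c, hu, hv, A.comm (A.mul u v) c] at h
  simp only [map_smul, LinearMap.smul_apply] at h
  rw [A.comm v c, A.comm u c, hu, hv] at h
  simp only [map_smul, LinearMap.smul_apply] at h
  rw [A.comm v u] at h
  linear_combination (norm := module) -h

lemma mul_e (A : EJA J) (x : J) : A.mul x A.e = x := by rw [A.comm, A.unit_mul]

lemma pair_rel (A : EJA J) {a b : J} (ha : A.mul a a = a) (hb : A.mul b b = b)
    (hab : A.mul a b = 0) (w : J) :
    A.mul a (A.mul a (A.mul b w)) = (1/2 : ℝ) • A.mul a (A.mul b w) := by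
  have hba : A.mul b a = 0 := by rw [A.comm, hab]
  have C : ∀ w, A.mul b (A.mul a w) = A.mul a (A.mul b w) := A.comm_orth ha hab
  have hs : A.mul (a + b) (a + b) = a + b := by
    simp [ha, hb, hab, hba]
  have key : ∀ w, A.mul a (A.mul b (A.mul b w)) = A.mul a (A.mul b w)
      - A.mul a (A.mul a (A.mul b w)) := by
    intro w
    have h := A.cubic hs w
    have h1 := A.cubic ha w
    have h2 := A.cubic hb w
    simp only [map_add, LinearMap.add_apply, C] at h
    linear_combination (norm := module) (1/6 : ℝ) • (h - h1 - h2)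
  have k1 := key w
  have k2 := key (A.mul a w)
  have k3 := key (A.mul b w)
  have c1 := A.cubic ha (A.mul b w)
  have c2 := A.cubic hb (A.mul a w)
  simp only [C] at k2 c2
  linear_combination (norm := module) k2 - (1/2 : ℝ) • c1 - k3 + (1/2 : ℝ) • c2 + (1/2 : ℝ) • k1

lemma triple_rel (A : EJA J) {a b c : J} (ha : A.mul a a = a) (hb : A.mul b b = b)
    (hc : A.mul c c = c) (hab : A.mul a b = 0) (hac : A.mul a c = 0) (hbc : A.mul b c = 0)
    (w : J) : A.mul a (A.mul b (A.mul c w)) = 0 := by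
  have hba : A.mul b a = 0 := by rw [A.comm, hab]
  have hca : A.mul c a = 0 := by rw [A.comm, hac]
  have hcb : A.mul c b = 0 := by rw [A.comm, hbc]
  have C1 : ∀ w, A.mul b (A.mul a w) = A.mul a (A.mul b w) := A.comm_orth ha hab
  have C2 : ∀ w, A.mul c (A.mul a w) = A.mul a (A.mul c w) := A.comm_orth ha hac
  have C3 : ∀ w, A.mul c (A.mul b w) = A.mul b (A.mul c w) := A.comm_orth hb hbc
  have hs : A.mul (a + b + c) (a + b + c) = a + b + c := by
    simp [ha, hb, hc, hab, hba, hac, hca, hbc, hcb]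
  have h := A.cubic hs w
  have h1 := A.cubic ha w
  have h2 := A.cubic hb w
  have h3 := A.cubic hc w
  have p1 := A.pair_rel ha hb hab w
  have p2 := A.pair_rel hb ha hba w
  have p3 := A.pair_rel ha hc hac w
  have p4 := A.pair_rel hc ha hca w
  have p5 := A.pair_rel hb hc hbc w
  have p6 := A.pair_rel hc hb hcb w
  simp only [map_add, LinearMap.add_apply, C1, C2, C3] at h p1 p2 p3 p4 p5 p6
  linear_combination (norm := module) (1/12 : ℝ) • (h - h1 - h2 - h3)
    - (1/2 : ℝ) • (p1 + p2 + p3 + p4 + p5 + p6)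

end Identities
end EJA
namespace EJA

section Frames

variable {J : Type} [NormedAddCommGroup J] [NormedSpace ℝ J] [FiniteDimensional ℝ J]

lemma IsFrame.idem {A : EJA J} {m : ℕ} {c : Fin m → J} (h : A.IsFrame c) (i : Fin m) :
    A.mul (c i) (c i) = c i := (h.1 i).1

lemma IsFrame.ne {A : EJA J} {m : ℕ} {c : Fin m → J} (h : A.IsFrame c) (i : Fin m) :
    c i ≠ 0 := (h.1 i).2.1

lemma IsFrame.orth {A : EJA J} {m : ℕ} {c : Fin m → J} (h : A.IsFrame c) {i j : Fin m}
    (hij : i ≠ j) : A.mul (c i) (c j) = 0 := h.2.1 i j hij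

lemma IsFrame.mul_basis {A : EJA J} {m : ℕ} {c : Fin m → J} (h : A.IsFrame c)
    (a : Fin m → ℝ) (i : Fin m) : A.mul (∑ j, a j • c j) (c i) = a i • c i := by
  rw [map_sum, LinearMap.sum_apply, Finset.sum_eq_single i]
  · simp [h.idem]
  · intro j _ hj
    simp [h.orth hj]
  · simp

lemma IsFrame.mul_sum {A : EJA J} {m : ℕ} {c : Fin m → J} (h : A.IsFrame c)
    (a b : Fin m → ℝ) :
    A.mul (∑ j, a j • c j) (∑ j, b j • c j) = ∑ j, (a j * b j) • c j := by
  rw [map_sum]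
  refine Finset.sum_congr rfl fun j _ => ?_
  rw [map_smul, h.mul_basis, smul_smul, mul_comm]

/-- Functional calculus stays in any subspace invariant under multiplication by `y`. -/
lemma IsFrame.fc_mem {A : EJA J} {m : ℕ} {f : Fin m → J} (h : A.IsFrame f)
    (μ : Fin m → ℝ) (V : Submodule ℝ J) (hy : (∑ j, μ j • f j) ∈ V)
    (hV : ∀ v ∈ V, A.mul (∑ j, μ j • f j) v ∈ V) (g : ℝ → ℝ) (g0 : g 0 = 0) :
    (∑ j, g (μ j) • f j) ∈ V := by
  have hpow : ∀ n : ℕ, (∑ j, (μ j) ^ (n + 1) • f j) ∈ V := by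
    intro n
    induction n with
    | zero => simpa using hy
    | succ n ih =>
      have := hV _ ih
      rw [h.mul_sum] at this
      convert this using 3
      ring
  let s : Finset ℝ := insert 0 (Finset.univ.image μ)
  let q := Lagrange.interpolate s id g
  have hq : ∀ t ∈ s, q.eval t = g t := fun t ht =>
    Lagrange.eval_interpolate_at_node (v := id) g (Function.injective_id.injOn) ht
  have hq0 : q.coeff 0 = 0 := by
    rw [Polynomial.coeff_zero_eq_eval_zero, hq 0 (by simp [s]), g0]
  have : ∑ j, g (μ j) • f j
      = ∑ n ∈ q.support, q.coeff n • ∑ j, (μ j) ^ n • f j := by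
    simp only [Finset.smul_sum, smul_smul]
    rw [Finset.sum_comm]
    refine Finset.sum_congr rfl fun j _ => ?_
    rw [← Finset.sum_smul, ← hq (μ j) (by simp [s]), Polynomial.eval_eq_sum, Polynomial.sum]
  rw [this]
  refine Submodule.sum_mem _ fun n hn => Submodule.smul_mem _ _ ?_
  cases n with
  | zero => simp [hq0] at hn
  | succ n => exact hpow n

lemma mem_peirce (A : EJA J) (c x : J) (t : ℝ) : x ∈ A.peirce c t ↔ A.mul c x = t • x := by
  simp [peirce, sub_eq_zero]

/-- For a primitive idempotent, `J(c,1)` is one-dimensional. -/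
lemma prim_one (A : EJA J) {c x : J} (hc : A.IsPrimitive c) (hx : A.mul c x = x) :
    ∃ t : ℝ, x = t • c := by
  obtain ⟨f, μ, hf, hxe⟩ := A.spectral x
  have hf : A.IsFrame f := hf
  by_cases h0 : ∀ j, μ j = 0
  · exact ⟨0, by simp [hxe, h0]⟩
  push Not at h0
  obtain ⟨j0, hj0⟩ := h0
  set g : ℝ → ℝ := fun t => if t = μ j0 then 1 else 0 with hg
  set F := ∑ j, g (μ j) • f j with hF
  have hFV : F ∈ A.peirce c 1 := by
    apply hf.fc_mem
    · rw [← hxe, mem_peirce, hx, one_smul]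
    · intro v hv
      rw [← hxe, mem_peirce, ← A.comm_one hc.1 hx]
      rw [mem_peirce] at hv
      rw [hv, map_smul]
    · simp [hg, hj0.symm]
  rw [mem_peirce, one_smul] at hFV
  have hFi : A.mul F F = F := by
    rw [hF, hf.mul_sum]
    refine Finset.sum_congr rfl fun j _ => ?_
    by_cases hj : μ j = μ j0 <;> simp [hg, hj]
  have hFx : A.mul F x = μ j0 • F := by
    rw [hF]
    conv_lhs => rw [hxe]
    rw [hf.mul_sum, Finset.smul_sum]
    refine Finset.sum_congr rfl fun j _ => ?_
    rw [smul_smul]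
    by_cases hj : μ j = μ j0 <;> simp [hg, hj]
  rcases hc.2.2 F hFi hFV with h | h
  · exfalso
    have := hf.mul_basis (fun j => g (μ j)) j0
    rw [← hF, h] at this
    simp only [map_zero, LinearMap.zero_apply, hg, if_true, one_smul] at this
    exact hf.ne j0 this.symm
  · rw [h, hx] at hFx
    exact ⟨_, hFx⟩

/-- Trace of a partial sum of a frame. -/
lemma IsFrame.tr_sum {A : EJA J} {m : ℕ} {c : Fin m → J} (h : A.IsFrame c) (S : Finset (Fin m)) :
    A.tr (∑ j ∈ S, c j) = S.card := by
  rw [map_sum, Finset.sum_congr rfl (fun j _ => A.tr_prim (c j) (h.1 j))]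
  simp

lemma ite_sum {m : ℕ} (c : Fin m → J) (lam : Fin m → ℝ) :
    ∑ j, (if lam j = 0 then (0 : ℝ) else 1) • c j
      = ∑ j ∈ Finset.univ.filter (fun j => lam j ≠ 0), c j := by
  rw [Finset.sum_filter]
  refine Finset.sum_congr rfl fun j _ => ?_
  by_cases h : lam j = 0 <;> simp [h]

/-- Support idempotent of an element: for `y` of rank `s`. -/
lemma support_idem (A : EJA J) {m : ℕ} {f : Fin m → J} (hf : A.IsFrame f) (μ : Fin m → ℝ)
    (V : Submodule ℝ J) (hy : (∑ j, μ j • f j) ∈ V)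
    (hV : ∀ v ∈ V, A.mul (∑ j, μ j • f j) v ∈ V) :
    ∃ s ∈ V, A.mul s s = s ∧ A.mul s (∑ j, μ j • f j) = (∑ j, μ j • f j) ∧
      A.mul s (A.mul (∑ j, μ j • f j) (∑ j, μ j • f j))
        = A.mul (∑ j, μ j • f j) (∑ j, μ j • f j) ∧
      A.tr s = (Finset.univ.filter fun j => μ j ≠ 0).card := by
  refine ⟨∑ j, (if μ j = 0 then (0 : ℝ) else 1) • f j, ?_, ?_, ?_, ?_, ?_⟩
  · exact hf.fc_mem μ V hy hV (fun t => if t = 0 then 0 else 1) (by simp)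
  · rw [hf.mul_sum]
    refine Finset.sum_congr rfl fun j _ => ?_
    by_cases h : μ j = 0 <;> simp [h]
  · rw [hf.mul_sum]
    refine Finset.sum_congr rfl fun j _ => ?_
    by_cases h : μ j = 0 <;> simp [h]
  · rw [hf.mul_sum, hf.mul_sum]
    refine Finset.sum_congr rfl fun j _ => ?_
    by_cases h : μ j = 0 <;> simp [h]
  · rw [ite_sum, hf.tr_sum]

end Frames
end EJA
namespace EJA

section Dims

variable {J : Type} [NormedAddCommGroup J] [NormedSpace ℝ J] [FiniteDimensional ℝ J]

lemma IsFrame.comm_all {A : EJA J} {m : ℕ} {c : Fin m → J} (h : A.IsFrame c) (i j : Fin m)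
    (w : J) : A.mul (c i) (A.mul (c j) w) = A.mul (c j) (A.mul (c i) w) := by
  by_cases hij : i = j
  · rw [hij]
  · exact A.comm_orth (h.idem j) (h.orth (Ne.symm hij)) w

lemma IsFrame.pair {A : EJA J} {m : ℕ} {c : Fin m → J} (h : A.IsFrame c) {i j : Fin m}
    (hij : i ≠ j) (w : J) : A.mul (c i) (A.mul (c i) (A.mul (c j) w))
      = (1/2 : ℝ) • A.mul (c i) (A.mul (c j) w) :=
  A.pair_rel (h.idem i) (h.idem j) (h.orth hij) w

lemma IsFrame.triple {A : EJA J} {m : ℕ} {c : Fin m → J} (h : A.IsFrame c) {i j k : Fin m}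
    (hij : i ≠ j) (hik : i ≠ k) (hjk : j ≠ k) (w : J) :
    A.mul (c i) (A.mul (c j) (A.mul (c k) w)) = 0 :=
  A.triple_rel (h.idem i) (h.idem j) (h.idem k) (h.orth hij) (h.orth hik) (h.orth hjk) w

lemma IsFrame.sum_mul {A : EJA J} {m : ℕ} {c : Fin m → J} (h : A.IsFrame c)
    (w : J) : ∑ i, A.mul (c i) w = w := by
  rw [← LinearMap.sum_apply, ← map_sum, h.2.2, A.unit_mul]

/-- The off-diagonal Peirce space. -/
noncomputable def pij (A : EJA J) {m : ℕ} (c : Fin m → J) (i j : Fin m) : Submodule ℝ J :=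
  A.peirce (c i) (1/2) ⊓ A.peirce (c j) (1/2)

lemma mem_pij (A : EJA J) {m : ℕ} (c : Fin m → J) (i j : Fin m) (x : J) :
    x ∈ A.pij c i j ↔ A.mul (c i) x = (1/2 : ℝ) • x ∧ A.mul (c j) x = (1/2 : ℝ) • x := by
  rw [pij, Submodule.mem_inf, mem_peirce, mem_peirce]

lemma pij_symm (A : EJA J) {m : ℕ} (c : Fin m → J) (i j : Fin m) :
    A.pij c i j = A.pij c j i := inf_comm _ _

lemma IsFrame.proj_pij {A : EJA J} {m : ℕ} {c : Fin m → J} (h : A.IsFrame c) {i j : Fin m}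
    (hij : i ≠ j) : LinearMap.IsProj (A.pij c i j) ((4 : ℝ) • (A.mul (c i) ∘ₗ A.mul (c j))) := by
  constructor
  · intro w
    rw [mem_pij]
    simp only [LinearMap.smul_apply, LinearMap.comp_apply, map_smul]
    rw [h.pair hij, h.comm_all i j w, h.pair hij.symm]
    constructor <;> module
  · intro x hx
    rw [mem_pij] at hx
    simp only [LinearMap.smul_apply, LinearMap.comp_apply, map_smul, hx.1, hx.2]
    module

lemma proj_one (A : EJA J) {c : J} (hc : A.mul c c = c) :
    LinearMap.IsProj (A.peirce c 1) ((2 : ℝ) • (A.mul c ∘ₗ A.mul c) - A.mul c) := by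
  constructor
  · intro w
    rw [mem_peirce]
    simp only [LinearMap.smul_apply, LinearMap.comp_apply, map_smul, LinearMap.sub_apply, map_sub]
    linear_combination (norm := module) A.cubic hc w
  · intro x hx
    rw [mem_peirce, one_smul] at hx
    simp only [LinearMap.smul_apply, LinearMap.comp_apply, LinearMap.sub_apply, hx]
    module

lemma IsFrame.finrank_diag {A : EJA J} {m : ℕ} {c : Fin m → J} (h : A.IsFrame c) (i : Fin m) :
    Module.finrank ℝ (A.peirce (c i) 1) = 1 := by
  have hm : c i ∈ A.peirce (c i) 1 := by rw [mem_peirce, h.idem, one_smul]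
  rw [finrank_eq_one_iff_of_nonzero' (⟨c i, hm⟩ : A.peirce (c i) 1)
    (by simpa using h.ne i)]
  rintro ⟨w, hw⟩
  rw [mem_peirce, one_smul] at hw
  obtain ⟨t, ht⟩ := A.prim_one (h.1 i) hw
  exact ⟨t, by ext; simp [ht]⟩

lemma IsFrame.idem_sum {A : EJA J} {m : ℕ} {c : Fin m → J} (h : A.IsFrame c)
    (T : Finset (Fin m)) : A.mul (∑ i ∈ T, c i) (∑ i ∈ T, c i) = ∑ i ∈ T, c i := by
  have : ∑ i ∈ T, c i = ∑ i, (if i ∈ T then (1 : ℝ) else 0) • c i := by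
    simp [Finset.sum_ite_mem]
  rw [this, h.mul_sum]
  refine Finset.sum_congr rfl fun j _ => ?_
  by_cases hj : j ∈ T <;> simp [hj]

lemma IsFrame.trace_sum {A : EJA J} {m : ℕ} {c : Fin m → J} (h : A.IsFrame c) (δ : ℕ)
    (hδ : ∀ i j, i ≠ j → Module.finrank ℝ (A.pij c i j) = δ) (T : Finset (Fin m)) :
    (Module.finrank ℝ (A.peirce (∑ i ∈ T, c i) 1) : ℝ)
      = T.card + T.card * (T.card - 1) / 2 * δ := by
  rw [← (A.proj_one (h.idem_sum T)).trace]
  have hd : ∀ i, 2 * LinearMap.trace ℝ J (A.mul (c i) ∘ₗ A.mul (c i))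
      = 1 + LinearMap.trace ℝ J (A.mul (c i)) := by
    intro i
    have := (A.proj_one (h.idem i)).trace
    rw [h.finrank_diag, map_sub, map_smul] at this
    simp only [smul_eq_mul] at this
    push_cast at this
    linarith
  have ho : ∀ i j, i ≠ j → LinearMap.trace ℝ J (A.mul (c i) ∘ₗ A.mul (c j)) = δ / 4 := by
    intro i j hij
    have := (h.proj_pij hij).trace
    rw [hδ i j hij, map_smul] at this
    simp only [smul_eq_mul] at this
    linarith
  have e1 : A.mul (∑ i ∈ T, c i) ∘ₗ A.mul (∑ i ∈ T, c i)
      = ∑ i ∈ T, ∑ j ∈ T, A.mul (c i) ∘ₗ A.mul (c j) := by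
    ext w
    simp [LinearMap.sum_apply]
  rw [map_sub, map_smul, e1]
  simp only [map_sum, smul_eq_mul, Finset.mul_sum]
  have e2 : ∀ i ∈ T, ∑ j ∈ T, 2 * LinearMap.trace ℝ J (A.mul (c i) ∘ₗ A.mul (c j))
      = 1 + LinearMap.trace ℝ J (A.mul (c i)) + (T.card - 1) * (δ / 2) := by
    intro i hi
    rw [← Finset.add_sum_erase _ _ hi, hd,
      Finset.sum_congr rfl (g := fun _ => (δ / 2 : ℝ))]
    · rw [Finset.sum_const, Finset.card_erase_of_mem hi, nsmul_eq_mul,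
        Nat.cast_pred (Finset.card_pos.2 ⟨i, hi⟩)]
    · intro j hj
      rw [ho i j (Finset.ne_of_mem_erase hj).symm]
      ring
  rw [Finset.sum_congr rfl e2, Finset.sum_add_distrib, Finset.sum_add_distrib]
  simp only [Finset.sum_const, nsmul_eq_mul]
  ring

lemma cast_tri (k : ℕ) : ((k * (k - 1) / 2 : ℕ) : ℝ) = (k : ℝ) * (k - 1) / 2 := by
  cases k with
  | zero => simp
  | succ n =>
    have h : 2 ∣ (n + 1) * (n + 1 - 1) := (Nat.even_mul_pred_self (n + 1)).two_dvd
    rw [Nat.cast_div h (by norm_num)]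
    push_cast
    simp

/-- Square of an off-diagonal element. -/
lemma IsFrame.sq_pij {A : EJA J} {m : ℕ} {c : Fin m → J} (h : A.IsFrame c) {i j : Fin m}
    (hij : i ≠ j) {x : J} (hx : x ∈ A.pij c i j) (hx0 : x ≠ 0) :
    ∃ α : ℝ, 0 < α ∧ A.mul x x = α • (c i + c j) := by
  rw [mem_pij] at hx
  obtain ⟨hi, hj⟩ := hx
  have hs : A.mul (c i + c j) (c i + c j) = c i + c j := by
    simp [h.idem, h.orth hij, h.orth hij.symm]
  have hsx : A.mul (c i + c j) x = x := by
    rw [map_add, LinearMap.add_apply, hi, hj]; module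
  have hsxx : A.mul (c i + c j) (A.mul x x) = A.mul x x := by
    rw [← A.comm_one hs hsx, hsx]
  rw [map_add, LinearMap.add_apply] at hsxx
  obtain ⟨α, hα⟩ := A.prim_one (h.1 i) (A.half_half (h.idem i) hi hi)
  obtain ⟨β, hβ⟩ := A.prim_one (h.1 j) (A.half_half (h.idem j) hj hj)
  have hxx : A.mul x x = α • c i + β • c j := by rw [← hsxx, hα, hβ]
  have hx3 : A.mul (A.mul x x) x = ((α + β) / 2) • x := by
    rw [hxx, map_add, map_smul, map_smul, LinearMap.add_apply, LinearMap.smul_apply,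
      LinearMap.smul_apply, hi, hj]
    module
  have h4 := A.jordan x x
  rw [hx3, map_smul, hxx] at h4
  simp only [map_add, map_smul, LinearMap.add_apply, LinearMap.smul_apply, h.idem, h.orth hij,
    h.orth hij.symm] at h4
  have e1 := congrArg (A.mul (c i)) h4
  have e2 := congrArg (A.mul (c j)) h4
  simp only [map_add, map_smul, h.idem, h.orth hij, h.orth hij.symm, smul_zero, add_zero,
    zero_add, smul_smul] at e1 e2
  have e1' := smul_left_injective ℝ (h.ne i) e1
  have e2' := smul_left_injective ℝ (h.ne j) e2
  have hab : α = β := by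
    have : (α - β) ^ 2 = 0 := by nlinarith
    have := pow_eq_zero_iff (two_ne_zero) |>.1 this
    linarith
  subst hab
  refine ⟨α, ?_, by rw [hxx, smul_add]⟩
  have := A.tr_posdef x hx0
  rw [hxx, map_add, map_smul, map_smul, A.tr_prim _ (h.1 i), A.tr_prim _ (h.1 j)] at this
  simp only [smul_eq_mul] at this
  linarith

lemma IsFrame.kill {A : EJA J} {m : ℕ} {c : Fin m → J} (h : A.IsFrame c) {i j k : Fin m}
    (hij : i ≠ j) (hik : i ≠ k) (hjk : j ≠ k) {x : J} (hx : x ∈ A.pij c i j) :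
    A.mul (c k) x = 0 := by
  have e := (h.proj_pij hij).map_id x hx
  rw [← e]
  simp only [LinearMap.smul_apply, LinearMap.comp_apply, map_smul]
  rw [h.triple hik.symm hjk.symm hij, smul_zero]

lemma IsFrame.mul_pij {A : EJA J} {m : ℕ} {c : Fin m → J} (h : A.IsFrame c) {i j k : Fin m}
    (hij : i ≠ j) (hik : i ≠ k) (hjk : j ≠ k) {x y : J} (hx : x ∈ A.pij c i j)
    (hy : y ∈ A.pij c i k) : A.mul x y ∈ A.pij c j k := by
  have kx := h.kill hij hik hjk hx
  have ky := h.kill hik hij hjk.symm hy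
  rw [mem_pij] at *
  constructor
  · rw [A.comm x y, ← A.comm_orth (h.idem j) ky, hx.2, map_smul]
  · rw [← A.comm_orth (h.idem k) kx, hy.2, map_smul]

lemma IsFrame.finrank_le {A : EJA J} {m : ℕ} {c : Fin m → J} (h : A.IsFrame c) {i j k : Fin m}
    (hij : i ≠ j) (hik : i ≠ k) (hjk : j ≠ k) (hne : A.pij c i j ≠ ⊥) :
    Module.finrank ℝ (A.pij c i k) ≤ Module.finrank ℝ (A.pij c j k) := by
  obtain ⟨x, hx, hx0⟩ := Submodule.exists_mem_ne_zero_of_ne_bot hne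
  obtain ⟨α, hα, hxx⟩ := h.sq_pij hij hx hx0
  have hmap : ∀ y ∈ A.pij c i k, A.mul x y ∈ A.pij c j k := fun y hy =>
    h.mul_pij hij hik hjk hx hy
  refine LinearMap.finrank_le_finrank_of_injective (f := (A.mul x).restrict hmap) ?_
  rw [← LinearMap.ker_eq_bot, LinearMap.ker_eq_bot']
  rintro ⟨y, hy⟩ hxy
  have hxy : A.mul x y = 0 := congrArg Subtype.val hxy
  have ky := h.kill hik hij hjk.symm hy
  rw [mem_pij] at hx hy
  have e := A.lin2 x (c i) y
  rw [hxy, hy.1, hxx] at e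
  simp only [map_smul, map_add, LinearMap.smul_apply, LinearMap.add_apply, h.idem,
    h.orth hij.symm, hy.1, ky, map_zero, smul_zero, add_zero, zero_add, smul_smul] at e
  have e2 : (α / 4) • y = 0 := by linear_combination (norm := module) e
  have : y = 0 := (smul_eq_zero.1 e2).resolve_left (by positivity)
  simp [this]

lemma IsFrame.connected {A : EJA J} {m : ℕ} {c : Fin m → J} (h : A.IsFrame c) (i0 j0 : Fin m)
    (hij0 : i0 ≠ j0) : A.pij c i0 j0 ≠ ⊥ := by
  intro hbot
  set C : Finset (Fin m) := Finset.univ.filter fun i => i = i0 ∨ A.pij c i0 i ≠ ⊥ with hC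
  have hbotij : ∀ i ∈ C, ∀ j, j ∉ C → A.pij c i j = ⊥ := by
    intro i hi j hj
    simp only [hC, Finset.mem_filter, Finset.mem_univ, true_and, not_or, not_not] at hi hj
    rcases hi with rfl | hi
    · exact hj.2
    · by_cases hii : i = i0
      · rw [hii]; exact hj.2
      have hij : i ≠ j := by rintro rfl; exact hi hj.2
      rw [pij_symm] at hi
      have := h.finrank_le hii hij (Ne.symm hj.1) hi
      rw [hj.2, finrank_bot] at this
      exact Submodule.finrank_eq_zero.1 (Nat.le_zero.1 this)
  have hzero : ∀ i ∈ C, ∀ j, j ∉ C → ∀ w, A.mul (c i) (A.mul (c j) w) = 0 := by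
    intro i hi j hj w
    have hij : i ≠ j := by rintro rfl; exact hj hi
    have := (h.proj_pij hij).map_mem w
    rw [hbotij i hi j hj, Submodule.mem_bot] at this
    simpa using this
  set p := ∑ i ∈ C, c i with hp
  have hpp : A.mul p p = p := h.idem_sum C
  have hcomp : ∀ w, w - A.mul p w = ∑ j ∈ Cᶜ, A.mul (c j) w := by
    intro w
    rw [sub_eq_iff_eq_add, hp, map_sum, LinearMap.sum_apply, Finset.sum_compl_add_sum]
    exact (h.sum_mul w).symm
  have hp2 : ∀ w, A.mul p (w - A.mul p w) = 0 := by
    intro w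
    rw [hcomp, hp, map_sum, map_sum]
    refine Finset.sum_eq_zero fun j hj => ?_
    rw [LinearMap.sum_apply]
    exact Finset.sum_eq_zero fun i hi => hzero i hi j (Finset.mem_compl.1 hj) w
  have hI := A.simple (A.peirce p 1) (by
    intro x hx y
    rw [mem_peirce, one_smul] at *
    have e1 : A.mul p (A.mul p y) = A.mul p y := by
      have := hp2 y
      rw [map_sub, sub_eq_zero] at this
      exact this.symm
    have e2 : A.mul y x = A.mul (A.mul p y) x := by
      have := A.one_zero hpp hx (hp2 y)
      rw [A.comm, map_sub, LinearMap.sub_apply, sub_eq_zero] at this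
      exact this
    rw [e2, ← A.comm_one hpp e1, hx])
  have hi0 : i0 ∈ C := by simp [hC]
  have hj0 : j0 ∉ C := by simp [hC, hbot, hij0.symm]
  rcases hI with hI | hI
  · have : p ∈ A.peirce p 1 := by rw [mem_peirce, hpp, one_smul]
    rw [hI, Submodule.mem_bot] at this
    have t := h.tr_sum C
    rw [← hp, this, map_zero] at t
    have : C.card = 0 := by exact_mod_cast t.symm
    rw [Finset.card_eq_zero] at this
    simp [this] at hi0
  · have : c j0 ∈ A.peirce p 1 := by rw [hI]; trivial
    rw [mem_peirce, one_smul, hp, map_sum, LinearMap.sum_apply, Finset.sum_eq_zero] at this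
    · exact h.ne j0 this.symm
    · intro i hi
      exact h.orth (by rintro rfl; exact hj0 hi)

lemma IsFrame.finrank_eq {A : EJA J} {m : ℕ} {c : Fin m → J} (h : A.IsFrame c) {i j k : Fin m}
    (hij : i ≠ j) (hik : i ≠ k) (hjk : j ≠ k) :
    Module.finrank ℝ (A.pij c i k) = Module.finrank ℝ (A.pij c j k) :=
  le_antisymm (h.finrank_le hij hik hjk (h.connected _ _ hij))
    (h.finrank_le hij.symm hjk hik (h.connected _ _ hij.symm))

lemma IsFrame.finrank_const {A : EJA J} {m : ℕ} {c : Fin m → J} (h : A.IsFrame c)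
    (i j k l : Fin m) (hij : i ≠ j) (hkl : k ≠ l) :
    Module.finrank ℝ (A.pij c i j) = Module.finrank ℝ (A.pij c k l) := by
  have key : ∀ i j k : Fin m, i ≠ k → j ≠ k →
      Module.finrank ℝ (A.pij c i k) = Module.finrank ℝ (A.pij c j k) := by
    intro i j k hik hjk
    by_cases hij : i = j
    · rw [hij]
    · exact h.finrank_eq hij hik hjk
  by_cases hkj : k = j
  · subst hkj
    rw [key i l k hij hkl.symm, pij_symm]
  · rw [key i k j hij hkj, pij_symm, A.pij_symm c k l]
    exact key j l k (Ne.symm hkj) (Ne.symm hkl)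

lemma IsFrame.finrank_pij {A : EJA J} {c : Fin A.rank → J} (h : A.IsFrame c) (d : ℕ)
    (hd : Module.finrank ℝ J = A.rank + A.rank * (A.rank - 1) / 2 * d)
    (i j : Fin A.rank) (hij : i ≠ j) : Module.finrank ℝ (A.pij c i j) = d := by
  have ht := h.trace_sum (Module.finrank ℝ (A.pij c i j))
    (fun k l hkl => h.finrank_const k l i j hkl hij) Finset.univ
  have htop : A.peirce (∑ i, c i) 1 = ⊤ := by
    rw [eq_top_iff]
    intro x _
    rw [mem_peirce, h.2.2, A.unit_mul, one_smul]
  rw [htop, finrank_top, hd, Finset.card_univ, Fintype.card_fin] at ht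
  push_cast [cast_tri] at ht
  have hr : (2 : ℝ) ≤ A.rank := by
    have : 2 ≤ A.rank := by
      have := i.2; have := j.2
      have : (i : ℕ) ≠ j := fun hh => hij (Fin.ext hh)
      omega
    exact_mod_cast this
  have hpos : (0 : ℝ) < A.rank * (A.rank - 1) / 2 := by
    have : (0:ℝ) < A.rank - 1 := by linarith
    positivity
  have := mul_left_cancel₀ hpos.ne' (add_left_cancel ht)
  exact_mod_cast this.symm

lemma IsFrame.finrank_sum {A : EJA J} {c : Fin A.rank → J} (h : A.IsFrame c) (d : ℕ)
    (hd : Module.finrank ℝ J = A.rank + A.rank * (A.rank - 1) / 2 * d)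
    (T : Finset (Fin A.rank)) :
    Module.finrank ℝ (A.peirce (∑ i ∈ T, c i) 1) = T.card + T.card * (T.card - 1) / 2 * d := by
  have := h.trace_sum d (h.finrank_pij d hd) T
  have e : ((T.card + T.card * (T.card - 1) / 2 * d : ℕ) : ℝ)
      = T.card + T.card * (T.card - 1) / 2 * d := by
    push_cast [cast_tri]; ring
  rw [← e] at this
  exact_mod_cast this

lemma d_pos (A : EJA J) (d : ℕ)
    (hd : Module.finrank ℝ J = A.rank + A.rank * (A.rank - 1) / 2 * d) (hr : 2 ≤ A.rank) :
    1 ≤ d := by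
  obtain ⟨c, _, h, _⟩ := A.spectral 0
  have h : A.IsFrame c := h
  have hij : (⟨0, by omega⟩ : Fin A.rank) ≠ ⟨1, by omega⟩ := by simp
  rw [← h.finrank_pij d hd _ _ hij]
  have := h.connected _ _ hij
  rw [Nat.one_le_iff_ne_zero]
  intro hh
  exact this (Submodule.finrank_eq_zero.1 hh)

end Dims
end EJA
namespace EJA

section Rank

variable {J : Type} [NormedAddCommGroup J] [NormedSpace ℝ J] [FiniteDimensional ℝ J]

lemma prim_map (A : EJA J) (g : J ≃ₗ[ℝ] J) (hg : ∀ a b, g (A.mul a b) = A.mul (g a) (g b))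
    {c : J} (hc : A.IsPrimitive c) : A.IsPrimitive (g c) := by
  refine ⟨?_, ?_, ?_⟩
  · show A.mul (g c) (g c) = g c
    rw [← hg]
    exact congrArg g hc.1
  · simpa using hc.2.1
  · intro d hd hcd
    have hd : A.mul d d = d := hd
    have hcd : A.mul (g c) d = d := hcd
    obtain ⟨d, rfl⟩ := g.surjective d
    rw [← hg] at hd hcd
    rcases hc.2.2 d (g.injective hd) (g.injective hcd) with h | h
    · left; simp [h]
    · right; rw [h]

lemma hasRank_map (A : EJA J) (g : J ≃ₗ[ℝ] J) (hg : ∀ a b, g (A.mul a b) = A.mul (g a) (g b))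
    {y : J} {s : ℕ} (hy : A.HasRank y s) : A.HasRank (g y) s := by
  obtain ⟨f, μ, hf, hye, hs⟩ := hy
  refine ⟨fun i => g (f i), μ, ⟨fun i => A.prim_map g hg (hf.1 i), ?_, ?_⟩, ?_, hs⟩
  · intro i j hij
    show A.mul (g (f i)) (g (f j)) = 0
    rw [← hg, hf.orth hij, map_zero]
  · show ∑ j, g (f j) = A.e
    rw [← map_sum, hf.2.2]
    obtain ⟨x, hx⟩ := g.surjective A.e
    have := hg A.e x
    rw [A.unit_mul, hx, A.mul_e] at this
    exact this.symm
  · rw [hye, map_sum]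
    simp

lemma support_full (A : EJA J) {c a s : J} (hc : A.mul c c = c) (ha : A.mul c a = a)
    (hinj : ∀ z, A.mul c z = z → (2 : ℝ) • A.mul a (A.mul a z) - A.mul (A.mul a a) z = 0 → z = 0)
    (hs : A.mul c s = s) (hsa : A.mul s a = a) (hsaa : A.mul s (A.mul a a) = A.mul a a) :
    s = c := by
  have hcaa : A.mul c (A.mul a a) = A.mul a a := by rw [← A.comm_one hc ha, ha]
  have h1 : A.mul a (c - s) = 0 := by
    rw [map_sub, A.comm a c, A.comm a s, ha, hsa, sub_self]
  have h2 : A.mul (A.mul a a) (c - s) = 0 := by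
    rw [map_sub, A.comm _ c, A.comm _ s, hcaa, hsaa, sub_self]
  have := hinj (c - s) (by rw [map_sub, hc, hs]) (by rw [h1, h2]; simp)
  exact (sub_eq_zero.1 this).symm

/-- Rank criterion for a block-diagonal element. -/
lemma rank_block (A : EJA J) {c a b : J} {n : ℕ} (hc : A.mul c c = c) (ha : A.mul c a = a)
    (hb : A.mul c b = 0) (hn : A.tr c = n)
    (hinj : ∀ z, A.mul c z = z →
      (2 : ℝ) • A.mul a (A.mul a z) - A.mul (A.mul a a) z = 0 → z = 0) :
    A.HasRank (a + b) n ↔ b = 0 := by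
  constructor
  · rintro ⟨f, μ, hf, hy, hcard⟩
    let V : Submodule ℝ J := LinearMap.ker (A.mul c ∘ₗ A.mul c - A.mul c)
    have memV : ∀ v, v ∈ V ↔ A.mul c (A.mul c v) = A.mul c v := by
      intro v
      simp [V, sub_eq_zero]
    have hcy : A.mul c (a + b) = a := by rw [map_add, ha, hb, add_zero]
    have split : ∀ v, A.mul c (A.mul (a + b) v) = A.mul (a + b) (A.mul c v) := by
      intro v
      rw [map_add, LinearMap.add_apply, LinearMap.add_apply, map_add, A.comm_one hc ha,
        A.comm_orth hc hb]
    obtain ⟨s, hsV, hss, hsy, hsyy, htr⟩ := A.support_idem hf μ V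
      (by rw [← hy, memV, hcy, ha])
      (by
        intro v hv
        rw [memV] at *
        rw [← hy, split, split, hv])
    rw [← hy] at hsy hsyy
    rw [hcard] at htr
    rw [memV] at hsV
    set s1 := A.mul c s with hs1
    set s0 := s - A.mul c s with hs0
    have hcs0 : A.mul c s0 = 0 := by rw [hs0, map_sub, hsV, sub_self]
    have hs : s = s1 + s0 := by rw [hs0]; abel
    have p10 : A.mul s1 s0 = 0 := A.one_zero hc hsV hcs0
    have p01 : A.mul s0 s1 = 0 := by rw [A.comm, p10]
    have q10 : A.mul s1 b = 0 := A.one_zero hc hsV hb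
    have q01 : A.mul s0 a = 0 := by rw [A.comm]; exact A.one_zero hc ha hcs0
    have r10 : A.mul a b = 0 := A.one_zero hc ha hb
    have r01 : A.mul b a = 0 := by rw [A.comm, r10]
    have c00 : ∀ u v, A.mul c u = 0 → A.mul c v = 0 → A.mul c (A.mul u v) = 0 := by
      intro u v hu hv
      rw [← A.comm_orth hc hu, hv, map_zero]
    have c11 : ∀ u v, A.mul c u = u → A.mul c v = v → A.mul c (A.mul u v) = A.mul u v := by
      intro u v hu hv
      rw [← A.comm_one hc hu, hv]
    rw [hs] at hss hsy hsyy
    simp only [map_add, LinearMap.add_apply, p10, p01, q10, q01, r10, r01, add_zero, zero_add]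
      at hss hsy hsyy
    have caa := c11 a a ha ha
    have cbb := c00 b b hb hb
    rw [A.one_zero hc hsV cbb, A.comm s0 (A.mul a a), A.one_zero hc caa hcs0] at hsyy
    have t1 := congrArg (A.mul c) hss
    have t2 := congrArg (A.mul c) hsy
    have t3 := congrArg (A.mul c) hsyy
    simp only [map_add, c11 s1 s1 hsV hsV, c00 s0 s0 hcs0 hcs0, c11 s1 a hsV ha,
      c00 s0 b hcs0 hb, c11 s1 _ hsV caa, c00 s0 _ hcs0 cbb, hsV, hcs0, ha, hb, caa, cbb,
      add_zero, zero_add] at t1 t2 t3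
    have hfull := A.support_full hc ha hinj hsV t2 t3
    rw [t1] at hss
    have u1 : A.mul s0 s0 = s0 := add_left_cancel hss
    rw [t2] at hsy
    have u2 : A.mul s0 b = b := add_left_cancel hsy
    have htr0 : A.tr s0 = 0 := by
      rw [hs, map_add, hfull, hn] at htr
      linarith
    by_contra hb0
    have hs00 : s0 ≠ 0 := by
      intro h0
      rw [h0] at u2
      simp at u2
      exact hb0 u2.symm
    have := A.tr_posdef s0 hs00
    rw [u1, htr0] at this
    exact lt_irrefl _ this
  · rintro rfl
    rw [add_zero]
    obtain ⟨f, μ, hf, hae⟩ := A.spectral a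
    refine ⟨f, μ, hf, hae, ?_⟩
    obtain ⟨s, hsV, hss, hsa, hsaa, htr⟩ := A.support_idem hf μ (A.peirce c 1)
      (by rw [← hae, mem_peirce, ha, one_smul])
      (by
        intro v hv
        rw [mem_peirce, one_smul] at *
        rw [← hae, ← A.comm_one hc ha, hv])
    rw [← hae] at hsa hsaa
    rw [mem_peirce, one_smul] at hsV
    rw [A.support_full hc ha hinj hsV hsa hsaa, hn] at htr
    exact_mod_cast htr.symm

/-- The product as a continuous bilinear map. -/
noncomputable def B (A : EJA J) : J →L[ℝ] J →L[ℝ] J :=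
  LinearMap.toContinuousLinearMap
    ((LinearMap.toContinuousLinearMap (E := J) (F' := J) (𝕜 := ℝ)).toLinearMap ∘ₗ A.mul)

@[simp] lemma B_apply (A : EJA J) (x y : J) : A.B x y = A.mul x y := rfl

open NormedSpace in
lemma exp_mul_neg (D : J →L[ℝ] J) : exp D * exp (-D) = 1 := by
  have : CompleteSpace J := FiniteDimensional.complete ℝ J
  have h := exp_add_of_commute_of_mem_ball (𝕂 := ℝ) (x := D) (y := -D)
    (Commute.neg_right (Commute.refl D))
    ((expSeries_radius_eq_top ℝ (J →L[ℝ] J)).symm ▸ edist_lt_top _ _)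
    ((expSeries_radius_eq_top ℝ (J →L[ℝ] J)).symm ▸ edist_lt_top _ _)
  rw [add_neg_cancel, exp_zero] at h
  exact h.symm

open NormedSpace in
/-- The exponential of a derivation is an automorphism. -/
lemma exp_aut (A : EJA J) (D : J →L[ℝ] J)
    (hD : ∀ a b, D (A.mul a b) = A.mul (D a) b + A.mul a (D b)) (a b : J) :
    exp D (A.mul a b) = A.mul (exp D a) (exp D b) := by
  have : CompleteSpace J := FiniteDimensional.complete ℝ J
  let G : ℝ → J := fun t => exp (t • (-D)) (A.B (exp (t • D) a) (exp (t • D) b))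
  have hu : ∀ (a : J) (t : ℝ), HasDerivAt (fun t : ℝ => exp (t • D) a) (D (exp (t • D) a)) t := by
    intro a t
    have := (hasDerivAt_exp_smul_const' (𝕂 := ℝ) D t).clm_apply (hasDerivAt_const t a)
    simpa using this
  have hG : ∀ t, HasDerivAt G 0 t := by
    intro t
    have h1 : HasDerivAt (fun t : ℝ => A.B (exp (t • D) a)) (A.B (D (exp (t • D) a))) t :=
      A.B.hasFDerivAt.comp_hasDerivAt t (hu a t)
    have h2 := h1.clm_apply (hu b t)
    have h3 := (hasDerivAt_exp_smul_const (𝕂 := ℝ) (-D) t).clm_apply h2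
    convert h3 using 1
    simp only [mul_apply_eq_comp, neg_apply, B_apply, map_neg,
      hD]
    simp
  have hc := is_const_of_deriv_eq_zero (f := G) (fun t => (hG t).differentiableAt)
    (fun t => (hG t).deriv) 0 1
  simp only [G, zero_smul, one_smul, exp_zero, one_apply_eq_self, B_apply] at hc
  rw [hc, ← mul_apply_eq_comp, exp_mul_neg, one_apply_eq_self]

open NormedSpace in
lemma hasRank_exp (A : EJA J) (D : J →L[ℝ] J)
    (hD : ∀ a b, D (A.mul a b) = A.mul (D a) b + A.mul a (D b)) (y : J) (s : ℕ) :
    A.HasRank (exp D y) s ↔ A.HasRank y s := by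
  have h1 := exp_mul_neg D
  have h2 := exp_mul_neg (-D)
  rw [neg_neg] at h2
  let g : J ≃ₗ[ℝ] J := LinearEquiv.ofLinearMap (exp D : J →L[ℝ] J).toLinearMap
    (exp (-D) : J →L[ℝ] J).toLinearMap
    (by ext z; exact congrArg (fun F : J →L[ℝ] J => F z) h1)
    (by ext z; exact congrArg (fun F : J →L[ℝ] J => F z) h2)
  have hg : ∀ z, g z = exp D z := fun z => rfl
  have hga : ∀ a b, g (A.mul a b) = A.mul (g a) (g b) := fun a b => A.exp_aut D hD a b
  constructor
  · intro h
    have := A.hasRank_map g.symm (by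
      intro a b
      apply g.injective
      rw [hga]
      simp) (y := g y) h
    simpa using this
  · intro h
    exact A.hasRank_map g hga h

end Rank
end EJA
namespace EJA

section Main

/-- Straightening by the inverse function theorem, with a globally smooth defining map. -/
lemma straighten {E F : Type} [NormedAddCommGroup E] [NormedSpace ℝ E] [FiniteDimensional ℝ E]
    [NormedAddCommGroup F] [NormedSpace ℝ F] (Φ : E → E) (x : E)
    (hΦ : ContDiff ℝ (⊤ : WithTop ℕ∞) Φ) (hx : Φ x = x) (Φ' : E →L[ℝ] E)
    (hΦ' : HasFDerivAt Φ Φ' x) (hinj : Function.Injective Φ') (π : E →L[ℝ] F)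
    (hπ : Function.Surjective π) (W : Set E) (hW : W ∈ nhds x) :
    ∃ f : E → F, ContDiff ℝ (⊤ : ℕ∞) f ∧ Function.Surjective (fderiv ℝ f x) ∧
      ∃ U ∈ nhds x, ∀ y ∈ U, ∃ z ∈ W, Φ z = y ∧ f y = π z := by
  have : CompleteSpace E := FiniteDimensional.complete ℝ E
  let e : E ≃L[ℝ] E := (LinearEquiv.ofInjectiveEndo Φ'.toLinearMap hinj).toContinuousLinearEquiv
  have he : (e : E →L[ℝ] E) = Φ' := by ext z; rfl
  rw [← he] at hΦ'
  have hc : ContDiffAt ℝ (⊤ : WithTop ℕ∞) Φ x := hΦ.contDiffAt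
  have hn : (⊤ : WithTop ℕ∞) ≠ 0 := by simp
  have hs := hc.hasStrictFDerivAt' hΦ' hn
  obtain ⟨g, hg⟩ : ∃ g, g = hs.localInverse Φ e x := ⟨_, rfl⟩
  have hgs : ContDiffAt ℝ (⊤ : WithTop ℕ∞) g x := by
    have := hc.to_localInverse hΦ' hn
    rw [hx] at this
    rw [hg]
    exact this
  have hgx : g x = x := by
    have := hs.localInverse_apply_image
    rw [hx] at this
    rw [hg]
    exact this
  have hgd : HasFDerivAt g (e.symm : E →L[ℝ] E) x := by
    have := hs.to_localInverse.hasFDerivAt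
    rw [hx] at this
    rw [hg]
    exact this
  have hri : ∀ᶠ y in nhds x, Φ (g y) = y := by
    have := hs.eventually_right_inverse
    rw [hx] at this
    rw [hg]
    exact this
  have hgW : ∀ᶠ y in nhds x, g y ∈ W := by
    apply hgs.continuousAt.eventually_mem
    rw [hgx]
    exact hW
  obtain ⟨ε, hε, hball⟩ := Metric.eventually_nhds_iff_ball.1 (hgs.eventually (by simp))
  let χ : ContDiffBump x := ⟨ε / 4, ε / 2, by linarith, by linarith⟩
  have hχ1 : ∀ᶠ y in nhds x, χ y = 1 := χ.eventuallyEq_one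
  have hfg : (fun y => χ y • π (g y)) =ᶠ[nhds x] fun y => π (g y) := by
    filter_upwards [hχ1] with y hy
    rw [hy, one_smul]
  refine ⟨fun y => χ y • π (g y), ?_, ?_, {y | Φ (g y) = y ∧ g y ∈ W ∧ χ y = 1}, ?_, ?_⟩
  · rw [contDiff_iff_contDiffAt]
    intro y
    by_cases hy : y ∈ Metric.ball x ε
    · refine χ.contDiffAt.smul (π.contDiff.contDiffAt.comp y ?_)
      exact (hball y hy).of_le le_top
    · have hy' : y ∉ tsupport χ := by
        rw [χ.tsupport_eq]
        intro hh
        apply hy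
        rw [Metric.mem_closedBall] at hh
        rw [Metric.mem_ball]
        have : χ.rOut = ε / 2 := rfl
        linarith
      have h0 : (fun y => χ y • π (g y)) =ᶠ[nhds y] fun _ => 0 := by
        filter_upwards [notMem_tsupport_iff_eventuallyEq.1 hy'] with z hz
        rw [hz]
        simp
      exact contDiffAt_const.congr_of_eventuallyEq h0
  · rw [hfg.fderiv_eq]
    have : HasFDerivAt (fun y => π (g y)) (π.comp (e.symm : E →L[ℝ] E)) x :=
      π.hasFDerivAt.comp x hgd
    rw [this.fderiv]
    exact hπ.comp e.symm.surjective
  · filter_upwards [hri, hgW, hχ1] with y h1 h2 h3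
    exact ⟨h1, h2, h3⟩
  · rintro y ⟨h1, h2, h3⟩
    exact ⟨g y, h2, h1, by simp [h3]⟩

variable {J : Type} [NormedAddCommGroup J] [NormedSpace ℝ J] [FiniteDimensional ℝ J]

lemma IsFrame.wt {A : EJA J} {m : ℕ} {c : Fin m → J} (h : A.IsFrame c) (lam : Fin m → ℝ)
    {i j : Fin m} (hij : i ≠ j) (w : J) :
    A.mul (c i) (A.mul (c j) (A.mul (∑ k, lam k • c k) w))
      = ((lam i + lam j) / 2) • A.mul (c i) (A.mul (c j) w) := by
  simp only [map_sum, LinearMap.sum_apply, map_smul, LinearMap.smul_apply]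
  rw [← Finset.add_sum_erase _ _ (Finset.mem_univ i),
    ← Finset.add_sum_erase _ _ (Finset.mem_erase.2 ⟨hij.symm, Finset.mem_univ j⟩),
    Finset.sum_eq_zero, h.comm_all j i w, h.pair hij, h.comm_all i j (A.mul (c j) w),
    h.comm_all i j w, h.pair hij.symm]
  · module
  · intro k hk
    simp only [Finset.mem_erase] at hk
    rw [h.triple hij (Ne.symm hk.2.1) (Ne.symm hk.1), smul_zero]

lemma IsFrame.wt_diag {A : EJA J} {m : ℕ} {c : Fin m → J} (h : A.IsFrame c) (lam : Fin m → ℝ)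
    (i : Fin m) (w : J) :
    (2 : ℝ) • A.mul (c i) (A.mul (c i) (A.mul (∑ k, lam k • c k) w))
        - A.mul (c i) (A.mul (∑ k, lam k • c k) w)
      = lam i • ((2 : ℝ) • A.mul (c i) (A.mul (c i) w) - A.mul (c i) w) := by
  simp only [map_sum, LinearMap.sum_apply, map_smul, LinearMap.smul_apply]
  rw [Finset.smul_sum, ← Finset.sum_sub_distrib, Finset.sum_eq_single i]
  · linear_combination (norm := module) lam i • A.cubic (h.idem i) w
  · intro k _ hk
    rw [h.pair (Ne.symm hk)]
    module
  · simp

lemma IsFrame.inj_P {A : EJA J} {m : ℕ} {c : Fin m → J} (h : A.IsFrame c) (lam : Fin m → ℝ)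
    (S : Finset (Fin m)) (hS : ∀ i ∈ S, lam i ≠ 0) (z : J)
    (hz : A.mul (∑ i ∈ S, c i) z = z)
    (h0 : (2 : ℝ) • A.mul (∑ k, lam k • c k) (A.mul (∑ k, lam k • c k) z)
      - A.mul (A.mul (∑ k, lam k • c k) (∑ k, lam k • c k)) z = 0) : z = 0 := by
  rw [h.mul_sum] at h0
  have hoff : ∀ i ∈ S, ∀ j ∈ S, i ≠ j → A.mul (c i) (A.mul (c j) z) = 0 := by
    intro i hi j hj hij
    have e := congrArg (fun v => A.mul (c i) (A.mul (c j) v)) h0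
    simp only [map_sub, map_smul, map_zero] at e
    rw [h.wt lam hij, h.wt lam hij, h.wt (fun k => lam k * lam k) hij] at e
    have e2 : (lam i * lam j) • A.mul (c i) (A.mul (c j) z) = 0 := by
      linear_combination (norm := module) e
    exact (smul_eq_zero.1 e2).resolve_left (mul_ne_zero (hS i hi) (hS j hj))
  have hdiag : ∀ i ∈ S, (2 : ℝ) • A.mul (c i) (A.mul (c i) z) - A.mul (c i) z = 0 := by
    intro i hi
    have e := congrArg (fun v => (2 : ℝ) • A.mul (c i) (A.mul (c i) v) - A.mul (c i) v) h0
    simp only [map_sub, map_smul, map_zero, smul_zero, sub_zero] at e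
    have e1 := h.wt_diag lam i (A.mul (∑ k, lam k • c k) z)
    have e3 := h.wt_diag lam i z
    have e4 := h.wt_diag (fun k => lam k * lam k) i z
    have e2 : (lam i * lam i) • ((2 : ℝ) • A.mul (c i) (A.mul (c i) z) - A.mul (c i) z) = 0 := by
      linear_combination (norm := module) e - (2 : ℝ) • e1 - ((2 : ℝ) * lam i) • e3 + e4
    exact (smul_eq_zero.1 e2).resolve_left (mul_ne_zero (hS i hi) (hS i hi))
  have hz2 : z = (2 : ℝ) • A.mul (∑ i ∈ S, c i) (A.mul (∑ i ∈ S, c i) z)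
      - A.mul (∑ i ∈ S, c i) z := by
    rw [hz, hz]; module
  rw [hz2]
  simp only [map_sum, LinearMap.sum_apply]
  rw [Finset.smul_sum, ← Finset.sum_sub_distrib]
  refine Finset.sum_eq_zero fun i hi => ?_
  rw [Finset.sum_eq_single_of_mem i hi, hdiag i hi]
  intro j hj hji
  exact hoff j hj i hi hji

lemma IsFrame.inj_half {A : EJA J} {m : ℕ} {c : Fin m → J} (h : A.IsFrame c) (lam : Fin m → ℝ)
    (S : Finset (Fin m)) (hS : ∀ i, i ∈ S ↔ lam i ≠ 0) (u : J)
    (hu : A.mul (∑ i ∈ S, c i) u = (1/2 : ℝ) • u)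
    (h0 : A.mul (∑ k, lam k • c k) u = 0) : u = 0 := by
  have hoff : ∀ i ∈ S, ∀ j ∈ Sᶜ, A.mul (c i) (A.mul (c j) u) = 0 := by
    intro i hi j hj
    have hj' := Finset.mem_compl.1 hj
    have hij : i ≠ j := by rintro rfl; exact hj' hi
    have hlj : lam j = 0 := by
      by_contra hh
      exact hj' ((hS j).2 hh)
    have e := h.wt lam hij u
    rw [h0, map_zero, map_zero, hlj, add_zero] at e
    exact (smul_eq_zero.1 e.symm).resolve_left
      (div_ne_zero ((hS i).1 hi) two_ne_zero)
  have hcomp : u - A.mul (∑ i ∈ S, c i) u = ∑ j ∈ Sᶜ, A.mul (c j) u := by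
    rw [sub_eq_iff_eq_add, map_sum, LinearMap.sum_apply, Finset.sum_compl_add_sum]
    exact (h.sum_mul u).symm
  have : A.mul (∑ i ∈ S, c i) (u - A.mul (∑ i ∈ S, c i) u) = 0 := by
    rw [hcomp]
    simp only [map_sum, LinearMap.sum_apply]
    exact Finset.sum_eq_zero fun i hi => Finset.sum_eq_zero fun j hj => hoff j hj i hi
  rw [map_sub, hu, map_smul, hu] at this
  have e2 : (1/4 : ℝ) • u = 0 := by linear_combination (norm := module) this
  exact (smul_eq_zero.1 e2).resolve_left (by norm_num)

open NormedSpace in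
lemma main_local (A : EJA J) (N n : ℕ) {c x : J} (hc : A.mul c c = c) (hcx : A.mul c x = x)
    (htr : A.tr c = n) (hN : Module.finrank ℝ (A.peirce (A.e - c) 1) = N)
    (hP : ∀ z, A.mul c z = z → (2 : ℝ) • A.mul x (A.mul x z) - A.mul (A.mul x x) z = 0 → z = 0)
    (hH : ∀ u, A.mul c u = (1/2 : ℝ) • u → A.mul x u = 0 → u = 0) :
    ∃ f : J → (Fin N → ℝ), ContDiff ℝ (⊤ : ℕ∞) f ∧ Function.Surjective (fderiv ℝ f x) ∧
        ∃ U ∈ nhds x, ∀ y ∈ U, (A.HasRank y n ↔ f y = 0) := by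
  have : CompleteSpace J := FiniteDimensional.complete ℝ J
  -- Peirce projections
  let L : J →L[ℝ] J := A.B c
  let P1 : J →L[ℝ] J := (2 : ℝ) • (L.comp L) - L
  let H : J →L[ℝ] J := (4 : ℝ) • (L - L.comp L)
  let Q : J →L[ℝ] J := ContinuousLinearMap.id ℝ J - H
  have P1a : ∀ z, P1 z = (2 : ℝ) • A.mul c (A.mul c z) - A.mul c z := fun z => rfl
  have Ha : ∀ z, H z = (4 : ℝ) • (A.mul c z - A.mul c (A.mul c z)) := fun z => rfl
  have Qa : ∀ z, Q z = z - H z := fun z => rfl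
  have cu := A.cubic hc
  have cP1 : ∀ z, A.mul c (P1 z) = P1 z := by
    intro z
    simp only [P1a, map_sub, map_smul]
    linear_combination (norm := module) cu z
  have cH : ∀ z, A.mul c (H z) = (1/2 : ℝ) • H z := by
    intro z
    simp only [Ha, map_sub, map_smul]
    linear_combination (norm := module) -(2 : ℝ) • cu z
  have P1id : ∀ z, A.mul c z = z → P1 z = z := by
    intro z hz
    rw [P1a, hz, hz]; module
  have Hid : ∀ z, A.mul c z = (1/2 : ℝ) • z → H z = z := by
    intro z hz
    rw [Ha, hz, map_smul, hz]; module
  have H1 : ∀ z, A.mul c z = z → H z = 0 := by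
    intro z hz
    rw [Ha, hz, hz]; simp
  have H0 : ∀ z, A.mul c z = 0 → H z = 0 := by
    intro z hz
    rw [Ha, hz, map_zero]; simp
  have P10 : ∀ z, A.mul c z = 0 → P1 z = 0 := by
    intro z hz
    rw [P1a, hz, map_zero]; simp
  have c0 : ∀ z, A.mul c (Q z - P1 z) = 0 := by
    intro z
    rw [map_sub, cP1, Qa, map_sub, cH, P1a, Ha]; module
  have HQ : ∀ z, H (Q z) = 0 := by
    intro z
    have : Q z = P1 z + (Q z - P1 z) := by abel
    rw [this, map_add, H1 _ (cP1 z), H0 _ (c0 z), add_zero]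
  -- derivations
  let Dm : J →L[ℝ] (J →L[ℝ] J) :=
    ((ContinuousLinearMap.compL ℝ J J J) L).comp A.B
      - ((ContinuousLinearMap.compL ℝ J J J).flip L).comp A.B
  have Da : ∀ u z, Dm u z = A.mul c (A.mul u z) - A.mul u (A.mul c z) := fun u z => rfl
  have Dder : ∀ u a b, Dm u (A.mul a b) = A.mul (Dm u a) b + A.mul a (Dm u b) := by
    intro u a b
    simp only [Da]
    exact A.deriv_comm c u a b
  let Φ : J → J := fun z => exp (Dm (H z)) (Q z)
  have hexp : ContDiff ℝ (⊤ : WithTop ℕ∞) (exp : (J →L[ℝ] J) → (J →L[ℝ] J)) := by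
    rw [contDiff_iff_contDiffAt]
    intro D
    exact (exp_analytic (𝕂 := ℝ) D).contDiffAt
  have hΦ : ContDiff ℝ (⊤ : WithTop ℕ∞) Φ :=
    (hexp.comp (Dm.comp H).contDiff).clm_apply Q.contDiff
  have hHx : H x = 0 := H1 x hcx
  have hQx : Q x = x := by rw [Qa, hHx, sub_zero]
  have hΦx : Φ x = x := by
    simp only [Φ, hHx, map_zero, exp_zero, hQx, one_apply_eq_self]
  let Φ' : J →L[ℝ] J := Q + (Dm.comp H).flip x
  have hΦ' : HasFDerivAt Φ Φ' x := by
    have h1 : HasFDerivAt (fun z => exp (Dm (H z))) (Dm.comp H) x := by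
      have h0 : HasFDerivAt (exp : (J →L[ℝ] J) → (J →L[ℝ] J))
          (1 : (J →L[ℝ] J) →L[ℝ] (J →L[ℝ] J)) ((Dm.comp H) x) := by
        have : (Dm.comp H) x = 0 := by
          show Dm (H x) = 0
          rw [hHx, map_zero]
        rw [this]
        exact hasFDerivAt_exp_zero
      exact h0.comp x (Dm.comp H).hasFDerivAt
    have h2 := h1.clm_apply Q.hasFDerivAt
    convert h2 using 1
    ext z
    simp [Φ', hHx, hQx, exp_zero]
  have Φ'a : ∀ z, Φ' z = Q z + Dm (H z) x := fun z => rfl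
  have hinj : Function.Injective Φ' := by
    rw [injective_iff_map_eq_zero]
    intro z hz
    have hxu : A.mul c (A.mul x (H z)) = (1/2 : ℝ) • A.mul x (H z) := by
      rw [← A.comm_one hc hcx, cH, map_smul]
    have hD : Dm (H z) x = -(1/2 : ℝ) • A.mul x (H z) := by
      rw [Da, hcx, A.comm (H z) x, hxu]; module
    have h1 := congrArg H hz
    rw [Φ'a, hD, map_add, HQ, map_smul, Hid _ hxu, map_zero, zero_add] at h1
    have h2 : A.mul x (H z) = 0 := (smul_eq_zero.1 h1).resolve_left (by norm_num)
    have h3 := hH _ (cH z) h2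
    rw [Φ'a, Qa, h3, map_zero] at hz
    simpa using hz
  -- open condition
  let T : J → (J →L[ℝ] J) := fun a =>
    ((2 : ℝ) • (A.B a).comp (A.B a) - A.B (A.B a a)).comp P1
      + (ContinuousLinearMap.id ℝ J - P1)
  have Ta : ∀ a z, T a z = ((2 : ℝ) • A.mul a (A.mul a (P1 z)) - A.mul (A.mul a a) (P1 z))
      + (z - P1 z) := fun a z => rfl
  have hTc : Continuous T := by fun_prop
  let W : Set J := {z | Function.Injective (T (P1 z))}
  have hWo : IsOpen W :=
    ContinuousLinearMap.isOpen_injective.preimage (hTc.comp P1.continuous)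
  have hxW : x ∈ W := by
    show Function.Injective (T (P1 x))
    rw [P1id x hcx, injective_iff_map_eq_zero]
    intro z hz
    have cx : ∀ w, A.mul c w = w → A.mul c (A.mul x w) = A.mul x w := by
      intro w hw
      rw [← A.comm_one hc hcx, hw]
    have cxx : ∀ w, A.mul c w = w → A.mul c (A.mul (A.mul x x) w) = A.mul (A.mul x x) w := by
      intro w hw
      rw [← A.comm_one hc (cx x hcx), hw]
    have h1 := congrArg P1 hz
    rw [Ta, map_add, map_zero, P1id, map_sub, P1id _ (cP1 z), sub_self, add_zero] at h1
    · have h2 := hP _ (cP1 z) h1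
      rw [Ta, h2] at hz
      simpa using hz
    · rw [map_sub, map_smul, cx _ (cx _ (cP1 z)), cxx _ (cP1 z)]
  -- the coordinate projection
  have mem0 : ∀ v, v ∈ A.peirce (A.e - c) 1 ↔ A.mul c v = 0 := by
    intro v
    rw [mem_peirce, one_smul, map_sub, LinearMap.sub_apply, A.unit_mul, sub_eq_self]
  let eq0 : A.peirce (A.e - c) 1 ≃ₗ[ℝ] (Fin N → ℝ) :=
    LinearEquiv.ofFinrankEq _ _ (by rw [hN]; simp)
  let π : J →L[ℝ] (Fin N → ℝ) := LinearMap.toContinuousLinearMap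
    (eq0.toLinearMap ∘ₗ (Q - P1).toLinearMap.codRestrict (A.peirce (A.e - c) 1)
      (fun z => (mem0 _).2 (c0 z)))
  have hπa : ∀ z, π z = eq0 ⟨Q z - P1 z, (mem0 _).2 (c0 z)⟩ := fun z => rfl
  have hπs : Function.Surjective π := by
    intro w
    refine ⟨(eq0.symm w : J), ?_⟩
    have hv := (mem0 _).1 (eq0.symm w).2
    rw [hπa]
    rw [← eq0.eq_symm_apply]
    ext
    show Q _ - P1 _ = _
    rw [Qa, H0 _ hv, P10 _ hv]
    simp
  have hπ0 : ∀ z, π z = 0 ↔ Q z - P1 z = 0 := by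
    intro z
    rw [hπa, LinearEquiv.map_eq_zero_iff]
    simp
  obtain ⟨f, hf1, hf2, U, hU, hfU⟩ := straighten Φ x hΦ hΦx Φ' hΦ' hinj π hπs W
    (hWo.mem_nhds hxW)
  refine ⟨f, hf1, hf2, U, hU, ?_⟩
  intro y hy
  obtain ⟨z, hzW, rfl, hfz⟩ := hfU y hy
  rw [hfz, hπ0]
  have hr := A.hasRank_exp (Dm (H z)) (Dder (H z)) (Q z) n
  rw [show Φ z = exp (Dm (H z)) (Q z) from rfl, hr]
  have hsplit : Q z = P1 z + (Q z - P1 z) := by abel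
  have hb := A.rank_block (n := n) hc (cP1 z) (c0 z) htr (by
    intro w hw h0
    have hW' : Function.Injective (T (P1 z)) := hzW
    rw [injective_iff_map_eq_zero] at hW'
    apply hW'
    rw [Ta, P1id w hw, h0]
    simp)
  rw [← hsplit] at hb
  exact hb

end Main
end EJA
/-- For `1 ≤ k ≤ r−1`, the set `J_k = {x : rank x = r−k}` is a smooth
submanifold of `J` of codimension `k + k(k−1)d/2` (locally, the regular zero set of a
smooth map into `ℝ^{k + k(k−1)d/2}`).  In particular `J₁` has codimension `1`, and for
`k ≥ 2` the codimension is at least `3`.  Here `d` is the Peirce invariant, defined by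
`dim J = r + r(r−1)d/2`. -/
theorem EJA.corank_stratum_submanifold {J : Type} [NormedAddCommGroup J] [NormedSpace ℝ J]
    [FiniteDimensional ℝ J] (A : EJA J) (d k : ℕ)
    (hd : Module.finrank ℝ J = A.rank + A.rank * (A.rank - 1) / 2 * d)
    (hk1 : 1 ≤ k) (hkr : k + 1 ≤ A.rank) :
    (∀ x : J, A.HasRank x (A.rank - k) →
      ∃ f : J → (Fin (k + k * (k - 1) / 2 * d) → ℝ),
        ContDiff ℝ (⊤ : ℕ∞) f ∧
        Function.Surjective (fderiv ℝ f x) ∧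
        ∃ U ∈ nhds x, ∀ y ∈ U, (A.HasRank y (A.rank - k) ↔ f y = 0)) ∧
    (k = 1 → k + k * (k - 1) / 2 * d = 1) ∧
    (2 ≤ k → 3 ≤ k + k * (k - 1) / 2 * d) := by
  refine ⟨?_, ?_, ?_⟩
  · rintro x ⟨c, lam, h, rfl, hcard⟩
    set S : Finset (Fin A.rank) := Finset.univ.filter fun j => lam j ≠ 0 with hS
    have hmem : ∀ i, i ∈ S ↔ lam i ≠ 0 := fun i => by simp [hS]
    have hcompl : (Sᶜ).card = k := by
      rw [Finset.card_compl, hcard, Fintype.card_fin]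
      omega
    have hsum : A.e - ∑ i ∈ S, c i = ∑ i ∈ Sᶜ, c i := by
      rw [sub_eq_iff_eq_add, Finset.sum_compl_add_sum]
      exact h.2.2.symm
    apply A.main_local _ _ (c := ∑ i ∈ S, c i) (h.idem_sum S)
    · rw [hS, ← EJA.ite_sum, h.mul_sum]
      refine Finset.sum_congr rfl fun j _ => ?_
      by_cases hj : lam j = 0 <;> simp [hj]
    · rw [h.tr_sum, hcard]
    · rw [hsum, h.finrank_sum d hd, hcompl]
    · exact h.inj_P lam S (fun i hi => (hmem i).1 hi)
    · exact h.inj_half lam S hmem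
  · rintro rfl
    simp
  · intro hk2
    have hdp := A.d_pos d hd (by omega)
    have h1 : 1 ≤ k * (k - 1) / 2 := by
      rw [Nat.one_le_div_iff (by norm_num)]
      calc 2 = 2 * 1 := rfl
        _ ≤ k * (k - 1) := Nat.mul_le_mul hk2 (by omega)
    have := Nat.mul_le_mul h1 hdp
    omega
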